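/- Let m ≥ 0 and let p be a real polynomial in two variables of total degree at most m. Then for every point z in the reference triangle T̂, the Euclidean norm of the gradient of p at z satisfies ‖∇p(z)‖ ≤ (4m²/√3) · sup_{w ∈ T̂} |p(w)|. -/

import Mathlib

/-- The reference equilateral triangle with vertices `(-1,0)`, `(1,0)`, `(0,√3)`,
as a subset of `Fin 2 → ℝ`. -/
def refTri2 : Set (Fin 2 → ℝ) :=
  {z | 0 ≤ z 1 ∧ z 1 ≤ Real.sqrt 3 * (1 + z 0) ∧ z 1 ≤ Real.sqrt 3 * (1 - z 0)}

open Polynomial in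
/-- The endpoint case of Markov's inequality. -/
theorem eval_derivative_one_le_of_abs_le {n : ℕ} {P : ℝ[X]} {M : ℝ} (hP : P.natDegree ≤ n)
    (hM : ∀ x ∈ Set.Icc (-1 : ℝ) 1, |P.eval x| ≤ M) :
    (derivative P).eval 1 ≤ (n : ℝ) ^ 2 * M := by
  have key : ∀ N > M, (derivative P).eval 1 ≤ (n : ℝ) ^ 2 * N := by
    intro N hN
    have hN0 : 0 < N := ((abs_nonneg _).trans (hM 0 (by norm_num))).trans_lt hN
    have h := Chebyshev.eval_iterate_derivative_le_of_forall_abs_le_one (n := n) (k := 1)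
      (P := C N⁻¹ * P) le_rfl
      (natDegree_le_iff_degree_le.1 ((natDegree_C_mul_le _ _).trans hP)) (fun x hx ↦ by
        rw [eval_mul, eval_C, abs_mul, abs_of_pos (inv_pos.2 hN0), inv_mul_le_one₀ hN0]
        exact (hM x hx).trans hN.le)
    have hT : (derivative (Chebyshev.T ℝ n)).eval 1 = (n : ℝ) ^ 2 := by
      simp [Chebyshev.T_derivative_eq_U, sq]
    simp only [Function.iterate_one, derivative_C_mul, eval_mul, eval_C, hT] at h
    rwa [inv_mul_le_iff₀ hN0, mul_comm] at h
  refine ge_of_tendsto (x := nhdsWithin M (Set.Ioi M)) (f := fun N ↦ (n : ℝ) ^ 2 * N) ?_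
    (Filter.eventually_of_mem self_mem_nhdsWithin key)
  exact (by fun_prop : Continuous fun N : ℝ ↦ (n : ℝ) ^ 2 * N).continuousWithinAt

open Polynomial in
/-- The chain rule for substituting univariate polynomials into a multivariate one. -/
theorem MvPolynomial.derivative_aeval {R σ : Type*} [CommSemiring R] [Fintype σ]
    (f : σ → R[X]) (p : MvPolynomial σ R) :
    derivative (MvPolynomial.aeval f p) =
      ∑ i, MvPolynomial.aeval f (MvPolynomial.pderiv i p) * derivative (f i) := by
  classical
  induction p using MvPolynomial.induction_on with
  | C a => simp [MvPolynomial.algHom_C]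
  | add p q hp hq => simp [hp, hq, add_mul, Finset.sum_add_distrib]
  | mul_X p i hp =>
    simp only [map_mul, MvPolynomial.aeval_X, derivative_mul, hp, MvPolynomial.pderiv_mul,
      MvPolynomial.pderiv_X, map_add, add_mul, Finset.sum_add_distrib, Finset.sum_mul]
    congr 1
    · exact Finset.sum_congr rfl fun _ _ ↦ by ring
    · rw [Finset.sum_eq_single i]
      · simp
      · intro j _ hj
        simp [hj.symm]
      · simp

theorem MvPolynomial.eval_aeval_line {σ : Type*} (c d : σ → ℝ) (p : MvPolynomial σ ℝ) (t : ℝ) :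
    (MvPolynomial.aeval (fun i ↦ Polynomial.C (c i) + Polynomial.C (d i) * Polynomial.X) p).eval t =
      MvPolynomial.eval (fun i ↦ c i + d i * t) p := by
  induction p using MvPolynomial.induction_on with
  | C a => simp [MvPolynomial.algHom_C]
  | add p q hp hq => simp [hp, hq]
  | mul_X p i hp => simp [hp]

/-- Markov's inequality along a segment, at an endpoint of the segment. -/
theorem MvPolynomial.sum_eval_pderiv_mul_sub_le {σ : Type*} [Fintype σ] {s : Set (σ → ℝ)}
    (hs : Convex ℝ s) {m : ℕ} {p : MvPolynomial σ ℝ} (hp : p.totalDegree ≤ m) {M : ℝ}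
    (hM : ∀ w ∈ s, |MvPolynomial.eval w p| ≤ M) {z v : σ → ℝ} (hz : z ∈ s) (hv : v ∈ s) :
    ∑ i, MvPolynomial.eval z (MvPolynomial.pderiv i p) * (z i - v i) ≤ 2 * ((m : ℝ) ^ 2 * M) := by
  let c : σ → ℝ := fun i ↦ (z i + v i) / 2
  let d : σ → ℝ := fun i ↦ (z i - v i) / 2
  have h := eval_derivative_one_le_of_abs_le (n := m) (M := M)
    (P := MvPolynomial.aeval (fun i ↦ Polynomial.C (c i) + Polynomial.C (d i) * Polynomial.X) p)
    ?_ ?_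
  · have hz' : (fun i ↦ c i + d i) = z := by
      ext i
      simp only [c, d]
      ring
    simp only [MvPolynomial.derivative_aeval, Polynomial.eval_finsetSum, Polynomial.eval_mul,
      MvPolynomial.eval_aeval_line, Polynomial.derivative_add, Polynomial.derivative_C,
      Polynomial.derivative_C_mul, Polynomial.derivative_X, Polynomial.eval_C, zero_add,
      mul_one, hz'] at h
    calc _ = 2 * ∑ i, MvPolynomial.eval z (MvPolynomial.pderiv i p) * d i := by
          rw [Finset.mul_sum]
          exact Finset.sum_congr rfl fun i _ ↦ by simp only [d]; ring
      _ ≤ _ := by gcongr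
  · refine (MvPolynomial.aeval_natDegree_le _ hp _ (n := 1) fun i ↦ ?_).trans (by simp)
    compute_degree
  · intro t ht
    rw [MvPolynomial.eval_aeval_line]
    refine hM _ ?_
    convert hs hz hv (a := (1 + t) / 2) (b := (1 - t) / 2) (by linarith [ht.1])
      (by linarith [ht.2]) (by ring) using 1
    ext i
    simp only [c, d, Pi.add_apply, Pi.smul_apply, smul_eq_mul]
    ring

theorem convex_refTri2 : Convex ℝ refTri2 := by
  rintro x ⟨hx0, hx1, hx2⟩ y ⟨hy0, hy1, hy2⟩ a b ha hb hab
  obtain rfl : b = 1 - a := by linarith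
  refine ⟨?_, ?_, ?_⟩ <;> simp only [Pi.add_apply, Pi.smul_apply, smul_eq_mul]
  · positivity
  · linarith [mul_le_mul_of_nonneg_left hx1 ha, mul_le_mul_of_nonneg_left hy1 hb]
  · linarith [mul_le_mul_of_nonneg_left hx2 ha, mul_le_mul_of_nonneg_left hy2 hb]

theorem isCompact_refTri2 : IsCompact refTri2 := by
  have hpos : 0 < √(3 : ℝ) := by positivity
  refine (isCompact_Icc (a := (![-1, 0] : Fin 2 → ℝ)) (b := ![1, √3])).of_isClosed_subset ?_ ?_
  · simp only [refTri2, Set.ofPred_and]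
    exact (isClosed_le (by fun_prop) (by fun_prop)).inter
      ((isClosed_le (by fun_prop) (by fun_prop)).inter (isClosed_le (by fun_prop) (by fun_prop)))
  · rintro z ⟨h0, h1, h2⟩
    have h3 : 0 ≤ 1 + z 0 := nonneg_of_mul_nonneg_right (h0.trans h1) hpos
    have h4 : 0 ≤ 1 - z 0 := nonneg_of_mul_nonneg_right (h0.trans h2) hpos
    constructor <;> intro i <;> fin_cases i <;> simp <;> nlinarith

theorem sq_add_sq_le_of_triangle_edges {a b K : ℝ} (h1 : |2 * a| ≤ 4 * K)
    (h2 : |a + √3 * b| ≤ 4 * K) (h3 : |a - √3 * b| ≤ 4 * K) :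
    a ^ 2 + b ^ 2 ≤ (4 * K / √3) ^ 2 := by
  have hsq : √(3 : ℝ) ^ 2 = 3 := Real.sq_sqrt (by norm_num)
  set x := a + √3 * b with hx
  set y := a - √3 * b with hy
  have hsum : x ^ 2 + y ^ 2 + (x + y) ^ 2 = 6 * (a ^ 2 + b ^ 2) := by
    rw [hx, hy]
    linear_combination 2 * b ^ 2 * hsq
  have h1 : |x + y| ≤ 4 * K := by
    rwa [show x + y = 2 * a by rw [hx, hy]; ring]
  have hx2 := sq_le_sq.2 (h2.trans (le_abs_self _))
  have hy2 := sq_le_sq.2 (h3.trans (le_abs_self _))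
  have hw2 := sq_le_sq.2 (h1.trans (le_abs_self _))
  have : x ^ 2 + y ^ 2 + (x + y) ^ 2 ≤ 2 * (4 * K) ^ 2 := by
    rcases le_total 0 (x * y) with hxy | hxy
    · nlinarith
    rcases le_total 0 (x * (x + y)) with hxw | hxw
    · nlinarith
    · nlinarith
  rw [div_pow, hsq]
  linarith

/-- Markov-type inverse estimate on the reference triangle (Lemma 5.2 /
Wilhelmsen's inequality with width `√3`): for a bivariate polynomial `p` of total
degree at most `m`, the Euclidean norm of its gradient at any point of `T̂` is
bounded by `(4m²/√3) · sup_{T̂} |p|`. -/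
theorem stmt_11 (m : ℕ) (p : MvPolynomial (Fin 2) ℝ) (hp : p.totalDegree ≤ m) :
    ∀ z ∈ refTri2,
      Real.sqrt ((MvPolynomial.eval z (MvPolynomial.pderiv 0 p)) ^ 2
          + (MvPolynomial.eval z (MvPolynomial.pderiv 1 p)) ^ 2)
        ≤ (4 * (m : ℝ) ^ 2 / Real.sqrt 3)
            * sSup ((fun w => |MvPolynomial.eval w p|) '' refTri2) := by
  intro z hz
  set M := sSup ((fun w => |MvPolynomial.eval w p|) '' refTri2)
  have hM : ∀ w ∈ refTri2, |MvPolynomial.eval w p| ≤ M := fun w hw ↦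
    le_csSup (isCompact_refTri2.image (MvPolynomial.continuous_eval p).abs).bddAbove (Set.mem_image_of_mem _ hw)
  have hM0 : 0 ≤ M := (abs_nonneg _).trans (hM z hz)
  have hvertex : ∀ v ∈ refTri2,
      |MvPolynomial.eval z (MvPolynomial.pderiv 0 p) * (z 0 - v 0) +
        MvPolynomial.eval z (MvPolynomial.pderiv 1 p) * (z 1 - v 1)| ≤ 2 * ((m : ℝ) ^ 2 * M) := by
    intro v hv
    have h1 := MvPolynomial.sum_eval_pderiv_mul_sub_le convex_refTri2 hp hM hz hv
    have h2 := MvPolynomial.sum_eval_pderiv_mul_sub_le convex_refTri2 (p := -p) (m := m)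
      (by rwa [MvPolynomial.totalDegree_neg]) (by simpa using hM) hz hv
    simp only [Fin.sum_univ_two, map_neg] at h1 h2
    exact abs_le.2 ⟨by linarith, h1⟩
  have hv1 := abs_le.1 (hvertex ![-1, 0] (by simp [refTri2]))
  have hv2 := abs_le.1 (hvertex ![1, 0] (by simp [refTri2]))
  have hv3 := abs_le.1 (hvertex ![0, √3] (by simp [refTri2]))
  simp only [Matrix.cons_val_zero, Matrix.cons_val_one] at hv1 hv2 hv3
  have hgrad := sq_add_sq_le_of_triangle_edges (K := (m : ℝ) ^ 2 * M)
    (a := MvPolynomial.eval z (MvPolynomial.pderiv 0 p))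
    (b := MvPolynomial.eval z (MvPolynomial.pderiv 1 p))
    (abs_le.2 ⟨by linarith, by linarith⟩) (abs_le.2 ⟨by linarith, by linarith⟩)
    (abs_le.2 ⟨by linarith, by linarith⟩)
  calc _ ≤ 4 * ((m : ℝ) ^ 2 * M) / √3 := Real.sqrt_le_iff.2 ⟨by positivity, hgrad⟩
    _ = _ := by ring
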